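/- arXiv:1702.04083 — 4 statements merged into one kernel-verified Lean document; each statement's English description precedes it below -/
import Mathlib

section
/- (Failure of genuine nonlinearity.) Let ρ > 0 and let λ₁(T) = −1/√(ρ ε'(T)) and λ₂(T) = 1/√(ρ ε'(T)). For i = 1, 2 and every real T, the quantity ∇λᵢ · rᵢ, which equals −ρ λᵢ(T) · λᵢ'(T), satisfies −ρ λᵢ(T) λᵢ'(T) = ε''(T) / (2 (ε'(T))²), and this quantity vanishes if and only if T = 0. Hence both characteristic fields are genuinely nonlinear at every T ≠ 0 but genuine nonlinearity fails at T = 0. -/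
/-- The strain–stress function `ε(T) = βT + α(1 + (γ/2)T²)ⁿ T`,
where the power with real exponent is `Real.rpow`. -/
noncomputable def eps (α β γ n : ℝ) : ℝ → ℝ :=
  fun T => β * T + α * (1 + γ / 2 * T ^ 2) ^ n * T

theorem one_add_half_mul_sq_pos {γ : ℝ} (hγ : 0 < γ) (x : ℝ) : 0 < 1 + γ / 2 * x ^ 2 := by
  positivity

theorem hasDerivAt_one_add_half_mul_sq_rpow {γ : ℝ} (hγ : 0 < γ) (p x : ℝ) :
    HasDerivAt (fun T : ℝ => (1 + γ / 2 * T ^ 2) ^ p)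
      (γ * x * p * (1 + γ / 2 * x ^ 2) ^ (p - 1)) x := by
  have h : HasDerivAt (fun T : ℝ => 1 + γ / 2 * T ^ 2) (γ * x) x := by
    refine (((hasDerivAt_pow 2 x).const_mul (γ / 2)).const_add 1).congr_deriv ?_
    norm_num
    ring
  exact h.rpow_const (Or.inl (one_add_half_mul_sq_pos hγ x).ne')

theorem deriv_eps (α β n : ℝ) {γ : ℝ} (hγ : 0 < γ) :
    deriv (eps α β γ n) = fun x => β + α * (1 + γ / 2 * x ^ 2) ^ n +
      α * n * γ * (x ^ 2 * (1 + γ / 2 * x ^ 2) ^ (n - 1)) := by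
  funext x
  have h := ((hasDerivAt_id' x).const_mul β).add
    (((hasDerivAt_one_add_half_mul_sq_rpow hγ n x).const_mul α).mul (hasDerivAt_id' x))
  refine (HasDerivAt.deriv (f := eps α β γ n) h).trans ?_
  ring

theorem deriv_eps_pos {α β γ n : ℝ} (hα : 0 < α) (hγ : 0 < γ) (hn : 0 < n)
    (hαβ : 0 < α + β) (x : ℝ) : 0 < deriv (eps α β γ n) x := by
  rw [deriv_eps α β n hγ]
  have h : 1 ≤ (1 + γ / 2 * x ^ 2) ^ n :=
    Real.one_le_rpow (le_add_of_nonneg_right (by positivity)) hn.le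
  have h' : 0 ≤ α * n * γ * (x ^ 2 * (1 + γ / 2 * x ^ 2) ^ (n - 1)) := by positivity
  dsimp only
  nlinarith

theorem hasDerivAt_deriv_eps (α β n : ℝ) {γ : ℝ} (hγ : 0 < γ) (x : ℝ) :
    HasDerivAt (deriv (eps α β γ n))
      (α * n * γ * (1 + γ / 2 * x ^ 2) ^ (n - 2) * (3 + (n + 1 / 2) * γ * x ^ 2) * x) x := by
  rw [deriv_eps α β n hγ]
  have h := (((hasDerivAt_one_add_half_mul_sq_rpow hγ n x).const_mul α).const_add β).add
    (((hasDerivAt_pow 2 x).mul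
      (hasDerivAt_one_add_half_mul_sq_rpow hγ (n - 1) x)).const_mul (α * n * γ))
  refine HasDerivAt.congr_deriv h ?_
  have hs : (1 + γ / 2 * x ^ 2) ^ (n - 1) =
      (1 + γ / 2 * x ^ 2) ^ (n - 2) * (1 + γ / 2 * x ^ 2) := by
    rw [← Real.rpow_add_one (one_add_half_mul_sq_pos hγ x).ne']
    ring_nf
  rw [show n - 1 - 1 = n - 2 by ring, hs]
  norm_num
  ring

theorem neg_mul_mul_deriv_div_sqrt {f : ℝ → ℝ} {f' ρ c x : ℝ} (hf : HasDerivAt f f' x)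
    (hρ : 0 < ρ) (hx : 0 < f x) (hc : c ^ 2 = 1) :
    -ρ * (c / √(ρ * f x)) * deriv (fun y => c / √(ρ * f y)) x = f' / (2 * f x ^ 2) := by
  have hpos : 0 < ρ * f x := mul_pos hρ hx
  have hd := (hasDerivAt_const x c).fun_div ((hf.const_mul ρ).sqrt hpos.ne')
    (Real.sqrt_pos.mpr hpos).ne'
  rw [hd.deriv]
  have hs : √(ρ * f x) ≠ 0 := (Real.sqrt_pos.mpr hpos).ne'
  have hs2 : √(ρ * f x) ^ 2 = ρ * f x := Real.sq_sqrt hpos.le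
  calc _ = c ^ 2 * ρ ^ 2 * f' / (2 * (√(ρ * f x) ^ 2) ^ 2) := by
        field_simp
        ring
    _ = _ := by
        rw [hs2, hc]
        field_simp

/-- Failure of genuine nonlinearity: for each characteristic speed
`λᵢ(T) = ∓1/√(ρ ε'(T))`, the quantity `∇λᵢ · rᵢ = −ρ λᵢ(T) λᵢ'(T)` equals
`ε''(T)/(2 ε'(T)²)`, and it vanishes iff `T = 0`. -/
theorem stmt_5 (α β γ n ρ : ℝ) (hα : 0 < α) (hβ : β < 0) (hγ : 0 < γ)
    (hn : 0 < n) (hαβ : 0 < α + β) (hρ : 0 < ρ) (T : ℝ) :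
    ∀ lam : ℝ → ℝ,
      (lam = fun x => -1 / Real.sqrt (ρ * deriv (eps α β γ n) x)) ∨
        (lam = fun x => 1 / Real.sqrt (ρ * deriv (eps α β γ n) x)) →
      -ρ * lam T * deriv lam T =
          deriv (deriv (eps α β γ n)) T / (2 * (deriv (eps α β γ n) T) ^ 2) ∧
        (-ρ * lam T * deriv lam T = 0 ↔ T = 0) := by
  intro lam hlam
  have hpos := deriv_eps_pos (β := β) hα hγ hn hαβ T
  have hd := hasDerivAt_deriv_eps α β n hγ T
  have key : -ρ * lam T * deriv lam T =
      deriv (deriv (eps α β γ n)) T / (2 * (deriv (eps α β γ n) T) ^ 2) := by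
    rw [hd.deriv]
    rcases hlam with rfl | rfl
    · exact neg_mul_mul_deriv_div_sqrt hd hρ hpos (by norm_num)
    · exact neg_mul_mul_deriv_div_sqrt hd hρ hpos (by norm_num)
  refine ⟨key, ?_⟩
  have hcoef : α * n * γ * (1 + γ / 2 * T ^ 2) ^ (n - 2) *
      (3 + (n + 1 / 2) * γ * T ^ 2) ≠ 0 := by positivity
  rw [key, hd.deriv, div_eq_zero_iff, or_iff_left (by positivity), mul_eq_zero,
    or_iff_right hcoef]
end

section
/- (Sign of the driving force and the physical admissibility criterion.) For all real T_l, T_r, the driving force f(T_l, T_r) has the same sign as (T_r − T_l)(T_r + T_l): f(T_l, T_r) > 0 if T_r² > T_l², f(T_l, T_r) < 0 if T_r² < T_l², and f(T_l, T_r) = 0 if and only if T_r = T_l or T_r = −T_l. Consequently, for any shock speed s ∈ ℝ, the dissipation-rate condition f(T_l, T_r)·s ≥ 0 holds if and only if s·(T_r − T_l)(T_r + T_l) ≥ 0. -/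
/-- The driving force at a stress discontinuity with left stress `T_l` and right
stress `T_r`: `f(T_l,T_r) = ∫_{T_r}^{T_l} ε(y) dy + ((ε(T_r)+ε(T_l))/2)(T_r − T_l)`. -/
noncomputable def drivingForce (α β γ n Tl Tr : ℝ) : ℝ :=
  (∫ y in Tr..Tl, eps α β γ n y) + (eps α β γ n Tr + eps α β γ n Tl) / 2 * (Tr - Tl)

/-- `sinh` grows superlinearly: `(n + 1) sinh (n t) < n sinh ((n + 1) t)` for `n, t > 0`. -/
theorem add_one_mul_sinh_lt {n t : ℝ} (hn : 0 < n) (ht : 0 < t) :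
    (n + 1) * Real.sinh (n * t) < n * Real.sinh ((n + 1) * t) := by
  let G : ℝ → ℝ := fun x => n * Real.sinh ((n + 1) * x) - (n + 1) * Real.sinh (n * x)
  have hG (x : ℝ) : HasDerivAt G
      (n * (n + 1) * (Real.cosh ((n + 1) * x) - Real.cosh (n * x))) x := by
    have h (c : ℝ) : HasDerivAt (fun y => Real.sinh (c * y)) (Real.cosh (c * x) * c) x := by
      simpa using ((hasDerivAt_id x).const_mul c).sinh
    exact (((h (n + 1)).const_mul n).sub ((h n).const_mul (n + 1))).congr_deriv (by ring)
  have hmono : StrictMonoOn G (Set.Ici 0) := by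
    refine strictMonoOn_of_deriv_pos (convex_Ici 0)
      (fun x _ => (hG x).continuousAt.continuousWithinAt) fun x hx => ?_
    rw [interior_Ici, Set.mem_Ioi] at hx
    rw [(hG x).deriv]
    refine mul_pos (by positivity) (sub_pos.2 (Real.cosh_lt_cosh.2 ?_))
    rw [abs_of_pos (by positivity), abs_of_pos (by positivity)]
    linarith
  have h0 := hmono Set.self_mem_Ici ht.le ht
  simp only [G, mul_zero, Real.sinh_zero, sub_zero] at h0
  linarith

/-- A strict mean inequality for powers of positive reals `v < u`, with the geometric mean
of `u` and `v` as weight. -/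
theorem rpow_sub_rpow_mul_sqrt_lt {n u v : ℝ} (hn : 0 < n) (hv : 0 < v) (huv : v < u) :
    (n + 1) * ((u ^ n - v ^ n) * √(u * v)) < n * (u ^ (n + 1) - v ^ (n + 1)) := by
  obtain ⟨m, t, rfl, rfl⟩ : ∃ m t, u = Real.exp (m + t) ∧ v = Real.exp (m - t) := by
    refine ⟨(Real.log u + Real.log v) / 2, (Real.log u - Real.log v) / 2, ?_, ?_⟩
    · rw [← add_div, add_add_sub_cancel, add_self_div_two, Real.exp_log (hv.trans huv)]
    · rw [← sub_div, add_sub_sub_cancel, add_self_div_two, Real.exp_log hv]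
  have ht : 0 < t := by linarith [Real.exp_lt_exp.1 huv]
  have hdiff (c : ℝ) : Real.exp (m + t) ^ c - Real.exp (m - t) ^ c =
      2 * Real.exp (m * c) * Real.sinh (c * t) := by
    rw [← Real.exp_mul, ← Real.exp_mul, Real.sinh_eq, add_mul, sub_mul, sub_eq_add_neg (m * c),
      Real.exp_add, Real.exp_add, mul_comm c t]
    ring
  have hsqrt : √(Real.exp (m + t) * Real.exp (m - t)) = Real.exp m := by
    rw [← Real.exp_add, add_add_sub_cancel, Real.exp_add, Real.sqrt_mul_self (Real.exp_pos m).le]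
  rw [hdiff, hdiff, hsqrt, mul_add m, mul_one, Real.exp_add]
  have := mul_lt_mul_of_pos_left (add_one_mul_sinh_lt hn ht)
    (by positivity : 0 < 2 * (Real.exp (m * n) * Real.exp m))
  linarith

theorem one_add_mul_sq_pos {γ : ℝ} (hγ : 0 < γ) (T : ℝ) : 0 < 1 + γ / 2 * T ^ 2 := by
  positivity

theorem integral_eps {α β γ n : ℝ} (hγ : 0 < γ) (hn : 0 < n) (a b : ℝ) :
    ∫ y in a..b, eps α β γ n y =
      (β / 2 * b ^ 2 + α / (γ * (n + 1)) * (1 + γ / 2 * b ^ 2) ^ (n + 1)) -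
        (β / 2 * a ^ 2 + α / (γ * (n + 1)) * (1 + γ / 2 * a ^ 2) ^ (n + 1)) := by
  have hderiv (y : ℝ) : HasDerivAt
      (fun x => β / 2 * x ^ 2 + α / (γ * (n + 1)) * (1 + γ / 2 * x ^ 2) ^ (n + 1))
      (eps α β γ n y) y := by
    have hsq := hasDerivAt_pow 2 y
    have hpow := ((hsq.const_mul (γ / 2)).const_add 1).rpow_const (p := n + 1)
      (Or.inl (one_add_mul_sq_pos hγ y).ne')
    refine ((hsq.const_mul (β / 2)).add (hpow.const_mul (α / (γ * (n + 1))))).congr_deriv ?_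
    have : n + 1 ≠ 0 := by positivity
    rw [add_sub_cancel_right]
    simp only [eps]
    field_simp
    ring
  have hcont : Continuous (eps α β γ n) := by
    have : Continuous fun T : ℝ => (1 + γ / 2 * T ^ 2) ^ n :=
      Continuous.rpow_const (by fun_prop) fun T => Or.inl (one_add_mul_sq_pos hγ T).ne'
    unfold eps
    fun_prop
  exact intervalIntegral.integral_eq_sub_of_hasDerivAt (fun y _ => hderiv y)
    (hcont.intervalIntegrable a b)

theorem drivingForce_swap (α β γ n Tl Tr : ℝ) :
    drivingForce α β γ n Tl Tr = -drivingForce α β γ n Tr Tl := by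
  simp only [drivingForce]
  rw [intervalIntegral.integral_symm]
  ring

/-- Closed form of the driving force; the linear part of `eps` does not contribute. -/
theorem drivingForce_eq {α β γ n : ℝ} (hγ : 0 < γ) (hn : 0 < n) (Tl Tr : ℝ) :
    drivingForce α β γ n Tl Tr = α / (γ * (n + 1)) *
      (n * ((1 + γ / 2 * Tr ^ 2) ^ (n + 1) - (1 + γ / 2 * Tl ^ 2) ^ (n + 1)) -
        (n + 1) * (((1 + γ / 2 * Tr ^ 2) ^ n - (1 + γ / 2 * Tl ^ 2) ^ n) *
          (1 + γ / 2 * (Tr * Tl)))) := by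
  have : n + 1 ≠ 0 := by positivity
  rw [drivingForce, integral_eps hγ hn]
  simp only [eps]
  rw [Real.rpow_add_one (one_add_mul_sq_pos hγ Tr).ne',
    Real.rpow_add_one (one_add_mul_sq_pos hγ Tl).ne']
  field_simp
  ring

theorem drivingForce_pos {α β γ n Tl Tr : ℝ} (hα : 0 < α) (hγ : 0 < γ) (hn : 0 < n)
    (h : Tl ^ 2 < Tr ^ 2) : 0 < drivingForce α β γ n Tl Tr := by
  have hv := one_add_mul_sq_pos hγ Tl
  have huv : 1 + γ / 2 * Tl ^ 2 < 1 + γ / 2 * Tr ^ 2 := by gcongr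
  rw [drivingForce_eq hγ hn]
  refine mul_pos (by positivity) (sub_pos.2 (lt_of_le_of_lt ?_
    (rpow_sub_rpow_mul_sqrt_lt hn hv huv)))
  have hpow := Real.rpow_lt_rpow hv.le huv hn
  refine mul_le_mul_of_nonneg_left (mul_le_mul_of_nonneg_left (Real.le_sqrt_of_sq_le ?_)
    (sub_pos.2 hpow).le) (by positivity)
  have : 0 ≤ γ / 2 * (Tr - Tl) ^ 2 := by positivity
  linarith

/-- If `Tl` and `Tr` have equal squares, the driving force vanishes. -/
theorem drivingForce_eq_zero {α β γ n Tl Tr : ℝ} (hγ : 0 < γ) (hn : 0 < n)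
    (h : Tl ^ 2 = Tr ^ 2) : drivingForce α β γ n Tl Tr = 0 := by
  rw [drivingForce_eq hγ hn, h]
  ring

/-- Sign of the driving force: `f(T_l,T_r)` has the same sign as
`(T_r − T_l)(T_r + T_l)`; in particular `f > 0` iff `T_r² > T_l²`, `f < 0` iff
`T_r² < T_l²`, `f = 0` iff `T_r = ±T_l`, and for any shock speed `s`,
`f·s ≥ 0 ↔ s(T_r − T_l)(T_r + T_l) ≥ 0`. -/
theorem stmt_9 (α β γ n : ℝ) (hα : 0 < α) (hβ : β < 0) (hγ : 0 < γ)
    (hn : 0 < n) (hαβ : 0 < α + β) (Tl Tr : ℝ) :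
    (Tl ^ 2 < Tr ^ 2 → 0 < drivingForce α β γ n Tl Tr) ∧
    (Tr ^ 2 < Tl ^ 2 → drivingForce α β γ n Tl Tr < 0) ∧
    (drivingForce α β γ n Tl Tr = 0 ↔ Tr = Tl ∨ Tr = -Tl) ∧
    (∀ s : ℝ, 0 ≤ drivingForce α β γ n Tl Tr * s ↔ 0 ≤ s * (Tr - Tl) * (Tr + Tl)) := by
  have hpos : Tl ^ 2 < Tr ^ 2 → 0 < drivingForce α β γ n Tl Tr := drivingForce_pos hα hγ hn
  have hneg (h : Tr ^ 2 < Tl ^ 2) : drivingForce α β γ n Tl Tr < 0 := by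
    rw [drivingForce_swap]
    exact neg_neg_of_pos (drivingForce_pos hα hγ hn h)
  have hfactor (s : ℝ) : s * (Tr - Tl) * (Tr + Tl) = (Tr ^ 2 - Tl ^ 2) * s := by ring
  refine ⟨hpos, hneg, ?_, fun s => ?_⟩
  · rw [← sq_eq_sq_iff_eq_or_eq_neg]
    refine ⟨fun h0 => ?_, fun h => drivingForce_eq_zero hγ hn h.symm⟩
    rcases lt_trichotomy (Tl ^ 2) (Tr ^ 2) with h | h | h
    · exact absurd h0 (hpos h).ne'
    · exact h.symm
    · exact absurd h0 (hneg h).ne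
  · rw [hfactor]
    rcases lt_trichotomy (Tl ^ 2) (Tr ^ 2) with h | h | h
    · rw [mul_nonneg_iff_of_pos_left (hpos h), mul_nonneg_iff_of_pos_left (sub_pos.2 h)]
    · simp [drivingForce_eq_zero hγ hn h, h]
    · rw [← neg_mul_neg, ← neg_mul_neg (Tr ^ 2 - Tl ^ 2),
        mul_nonneg_iff_of_pos_left (neg_pos.2 (hneg h)),
        mul_nonneg_iff_of_pos_left (neg_pos.2 (sub_neg.2 h))]
end

section
/- (Existence and uniqueness of the maximally dissipative tangency point.) If T_l < 0, then there exists a unique real number T₂ with T₂ > T_l satisfying ε(T₂) − ε(T_l) = ε'(T₂)·(T₂ − T_l), and moreover T₂ > 0. Symmetrically, if T_l > 0, then there exists a unique real number T₃ with T₃ < T_l satisfying ε(T₃) − ε(T_l) = ε'(T₃)·(T₃ − T_l), and moreover T₃ < 0. -/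
/-- The first derivative of `eps α β γ n`. -/
noncomputable def epsDeriv (α β γ n T : ℝ) : ℝ :=
  β + α * ((1 + γ / 2 * T ^ 2) ^ n + n * γ * T ^ 2 * (1 + γ / 2 * T ^ 2) ^ (n - 1))

/-- The second derivative of `eps α β γ n`. -/
noncomputable def epsDerivTwo (α γ n T : ℝ) : ℝ :=
  α * n * γ * (1 + γ / 2 * T ^ 2) ^ (n - 2) * (3 + (n + 1 / 2) * γ * T ^ 2) * T

theorem hasDerivAt_one_add_mul_sq_rpow {γ : ℝ} (hγ : 0 < γ) (m T : ℝ) :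
    HasDerivAt (fun T : ℝ => (1 + γ / 2 * T ^ 2) ^ m)
      (γ * T * m * (1 + γ / 2 * T ^ 2) ^ (m - 1)) T := by
  have h : HasDerivAt (fun T : ℝ => 1 + γ / 2 * T ^ 2) (γ * T) T := by
    refine (((hasDerivAt_pow 2 T).const_mul (γ / 2)).const_add 1).congr_deriv ?_
    push_cast
    ring
  exact h.rpow_const (Or.inl (one_add_mul_sq_pos hγ T).ne')

theorem hasDerivAt_eps {γ : ℝ} (α β n : ℝ) (hγ : 0 < γ) (T : ℝ) :
    HasDerivAt (eps α β γ n) (epsDeriv α β γ n T) T := by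
  have h := ((hasDerivAt_id' T).const_mul β).add
    (((hasDerivAt_one_add_mul_sq_rpow hγ n T).const_mul α).mul (hasDerivAt_id' T))
  refine h.congr_deriv ?_
  unfold epsDeriv
  ring

theorem hasDerivAt_epsDeriv {γ : ℝ} (α β n : ℝ) (hγ : 0 < γ) (T : ℝ) :
    HasDerivAt (epsDeriv α β γ n) (epsDerivTwo α γ n T) T := by
  have h := (((hasDerivAt_one_add_mul_sq_rpow hγ n T).add
    (((hasDerivAt_pow 2 T).const_mul (n * γ)).mul
      (hasDerivAt_one_add_mul_sq_rpow hγ (n - 1) T))).const_mul α).const_add β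
  refine h.congr_deriv ?_
  have hu := one_add_mul_sq_pos hγ T
  have hpow : (1 + γ / 2 * T ^ 2) ^ (n - 1) =
      (1 + γ / 2 * T ^ 2) ^ (n - 2) * (1 + γ / 2 * T ^ 2) := by
    rw [← Real.rpow_add_one hu.ne']
    congr 1
    ring
  have hexp : n - 1 - 1 = n - 2 := by ring
  rw [hexp, hpow]
  unfold epsDerivTwo
  push_cast
  ring

theorem epsDerivTwo_eq_pos_mul {α γ n : ℝ} (hα : 0 < α) (hγ : 0 < γ) (hn : 0 < n) (T : ℝ) :
    ∃ c, 0 < c ∧ epsDerivTwo α γ n T = c * T := by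
  have hu := Real.rpow_pos_of_pos (one_add_mul_sq_pos hγ T) (n - 2)
  exact ⟨_, by positivity, rfl⟩

theorem eps_neg (α β γ n T : ℝ) : eps α β γ n (-T) = -eps α β γ n T := by
  simp only [eps, neg_sq]
  ring

theorem epsDeriv_neg (α β γ n T : ℝ) : epsDeriv α β γ n (-T) = epsDeriv α β γ n T := by
  simp only [epsDeriv, neg_sq]

theorem eps_lt_mul_epsDeriv {α γ n T : ℝ} (β : ℝ) (hα : 0 < α) (hγ : 0 < γ) (hn : 0 < n)
    (hT : 0 < T) : eps α β γ n T < epsDeriv α β γ n T * T := by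
  have hu := Real.rpow_pos_of_pos (one_add_mul_sq_pos hγ T) (n - 1)
  have h : 0 < α * (n * γ * T ^ 2 * (1 + γ / 2 * T ^ 2) ^ (n - 1)) * T := by positivity
  unfold eps epsDeriv
  linarith

/-- The tangency defect: it vanishes at `T` exactly when the tangent at `T` passes through
the point of the curve over `Tl`. -/
noncomputable def tangencyDefect (α β γ n Tl T : ℝ) : ℝ :=
  epsDeriv α β γ n T * (T - Tl) - (eps α β γ n T - eps α β γ n Tl)

theorem hasDerivAt_tangencyDefect {γ : ℝ} (α β n : ℝ) (hγ : 0 < γ) (Tl T : ℝ) :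
    HasDerivAt (tangencyDefect α β γ n Tl) (epsDerivTwo α γ n T * (T - Tl)) T := by
  have h := ((hasDerivAt_epsDeriv α β n hγ T).mul ((hasDerivAt_id' T).sub_const Tl)).sub
    ((hasDerivAt_eps α β n hγ T).sub_const (eps α β γ n Tl))
  refine h.congr_deriv ?_
  ring

theorem continuous_tangencyDefect {γ : ℝ} (α β n : ℝ) (hγ : 0 < γ) (Tl : ℝ) :
    Continuous (tangencyDefect α β γ n Tl) :=
  continuous_iff_continuousAt.2 fun T => (hasDerivAt_tangencyDefect α β n hγ Tl T).continuousAt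

theorem strictAntiOn_tangencyDefect {α γ n : ℝ} (β : ℝ) (hα : 0 < α) (hγ : 0 < γ) (hn : 0 < n)
    (Tl : ℝ) : StrictAntiOn (tangencyDefect α β γ n Tl) (Set.Icc Tl 0) := by
  refine strictAntiOn_of_deriv_neg (convex_Icc _ _)
    (continuous_tangencyDefect α β n hγ Tl).continuousOn fun T hT => ?_
  rw [interior_Icc] at hT
  obtain ⟨c, hc, h⟩ := epsDerivTwo_eq_pos_mul hα hγ hn T
  rw [(hasDerivAt_tangencyDefect α β n hγ Tl T).deriv, h]
  exact mul_neg_of_neg_of_pos (mul_neg_of_pos_of_neg hc hT.2) (sub_pos.2 hT.1)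

theorem strictMonoOn_tangencyDefect {α γ n Tl : ℝ} (β : ℝ) (hα : 0 < α) (hγ : 0 < γ)
    (hn : 0 < n) (hTl : Tl < 0) : StrictMonoOn (tangencyDefect α β γ n Tl) (Set.Ici 0) := by
  refine strictMonoOn_of_deriv_pos (convex_Ici _)
    (continuous_tangencyDefect α β n hγ Tl).continuousOn fun T hT => ?_
  rw [interior_Ici] at hT
  obtain ⟨c, hc, h⟩ := epsDerivTwo_eq_pos_mul hα hγ hn T
  rw [(hasDerivAt_tangencyDefect α β n hγ Tl T).deriv, h]
  exact mul_pos (mul_pos hc hT) (sub_pos.2 (hTl.trans hT))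

theorem tangencyDefect_neg_of_nonpos {α γ n Tl T : ℝ} (β : ℝ) (hα : 0 < α) (hγ : 0 < γ)
    (hn : 0 < n) (hT : Tl < T) (hT0 : T ≤ 0) : tangencyDefect α β γ n Tl T < 0 := by
  have h := strictAntiOn_tangencyDefect β hα hγ hn Tl
    (Set.left_mem_Icc.2 (hT.le.trans hT0)) ⟨hT.le, hT0⟩ hT
  simpa [tangencyDefect] using h

theorem pos_of_tangencyDefect_eq_zero {α γ n Tl T : ℝ} (β : ℝ) (hα : 0 < α) (hγ : 0 < γ)
    (hn : 0 < n) (hT : Tl < T) (h : tangencyDefect α β γ n Tl T = 0) : 0 < T := by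
  by_contra! hT0
  exact (tangencyDefect_neg_of_nonpos β hα hγ hn hT hT0).ne h

theorem existsUnique_tangencyDefect_eq_zero {α γ n Tl : ℝ} (β : ℝ) (hα : 0 < α) (hγ : 0 < γ)
    (hn : 0 < n) (hTl : Tl < 0) :
    ∃! T, Tl < T ∧ tangencyDefect α β γ n Tl T = 0 := by
  have h0 := tangencyDefect_neg_of_nonpos β hα hγ hn hTl le_rfl
  have h1 : 0 < tangencyDefect α β γ n Tl (-Tl) := by
    have h := eps_lt_mul_epsDeriv β hα hγ hn (neg_pos.2 hTl)
    have hodd := eps_neg α β γ n Tl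
    unfold tangencyDefect
    linarith
  obtain ⟨T, hT, hzero⟩ := intermediate_value_Icc (neg_pos.2 hTl).le
    (continuous_tangencyDefect α β n hγ Tl).continuousOn ⟨h0.le, h1.le⟩
  refine ⟨T, ⟨hTl.trans_le hT.1, hzero⟩, fun S hS => ?_⟩
  exact (strictMonoOn_tangencyDefect β hα hγ hn hTl).injOn
    (pos_of_tangencyDefect_eq_zero β hα hγ hn hS.1 hS.2).le hT.1 (hS.2.trans hzero.symm)

theorem tangency_iff {γ : ℝ} (α β n : ℝ) (hγ : 0 < γ) (Tl T : ℝ) :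
    eps α β γ n T - eps α β γ n Tl = deriv (eps α β γ n) T * (T - Tl) ↔
      tangencyDefect α β γ n Tl T = 0 := by
  rw [(hasDerivAt_eps α β n hγ T).deriv, tangencyDefect, sub_eq_zero, eq_comm]

theorem tangencyDefect_neg_neg (α β γ n Tl T : ℝ) :
    tangencyDefect α β γ n (-Tl) (-T) = -tangencyDefect α β γ n Tl T := by
  simp only [tangencyDefect, eps_neg, epsDeriv_neg]
  ring

/-- Existence and uniqueness of the maximally dissipative tangency point: for
`T_l < 0` there is a unique `T₂ > T_l` with `ε(T₂) − ε(T_l) = ε'(T₂)(T₂ − T_l)`,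
and moreover `T₂ > 0`; symmetrically for `T_l > 0` there is a unique `T₃ < T_l`
with `ε(T₃) − ε(T_l) = ε'(T₃)(T₃ − T_l)`, and moreover `T₃ < 0`. -/
theorem stmt_11 (α β γ n : ℝ) (hα : 0 < α) (hβ : β < 0) (hγ : 0 < γ)
    (hn : 0 < n) (hαβ : 0 < α + β) :
    (∀ Tl : ℝ, Tl < 0 →
      (∃! T₂ : ℝ, Tl < T₂ ∧
        eps α β γ n T₂ - eps α β γ n Tl = deriv (eps α β γ n) T₂ * (T₂ - Tl)) ∧
      (∀ T₂ : ℝ, Tl < T₂ →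
        eps α β γ n T₂ - eps α β γ n Tl = deriv (eps α β γ n) T₂ * (T₂ - Tl) →
        0 < T₂)) ∧
    (∀ Tl : ℝ, 0 < Tl →
      (∃! T₃ : ℝ, T₃ < Tl ∧
        eps α β γ n T₃ - eps α β γ n Tl = deriv (eps α β γ n) T₃ * (T₃ - Tl)) ∧
      (∀ T₃ : ℝ, T₃ < Tl →
        eps α β γ n T₃ - eps α β γ n Tl = deriv (eps α β γ n) T₃ * (T₃ - Tl) →
        T₃ < 0)) := by
  simp only [tangency_iff α β n hγ]
  refine ⟨fun Tl hTl => ⟨existsUnique_tangencyDefect_eq_zero β hα hγ hn hTl,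
    fun T hT h => pos_of_tangencyDefect_eq_zero β hα hγ hn hT h⟩, fun Tl hTl => ⟨?_, ?_⟩⟩
  · obtain ⟨T, ⟨hT, hzero⟩, huniq⟩ :=
      existsUnique_tangencyDefect_eq_zero β hα hγ hn (neg_neg_of_pos hTl)
    refine ⟨-T, ⟨neg_lt.1 hT, ?_⟩, fun S hS => ?_⟩
    · simpa [hzero] using tangencyDefect_neg_neg α β γ n (-Tl) T
    · rw [← huniq (-S) ⟨neg_lt_neg hS.1, by rw [tangencyDefect_neg_neg, hS.2, neg_zero]⟩, neg_neg]
  · intro T hT h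
    exact neg_pos.1 (pos_of_tangencyDefect_eq_zero β hα hγ hn (neg_lt_neg hT)
      (by rw [tangencyDefect_neg_neg, h, neg_zero]))
end

section
/- (Speed inequalities for the degenerate forward shock issuing from zero stress.) Let ρ > 0 and T ≠ 0. Then α + β = ε'(0) < ε(T)/T < ε'(T); consequently the shock speed s₂ = 1/√(ρ·ε(T)/T) of a forward shock connecting the stress 0 to the stress T satisfies λ₂(0) > s₂ > λ₂(T), where λ₂(x) = 1/√(ρ ε'(x)). -/
theorem hasDerivAt_eps_s16 (α β n x : ℝ) {γ : ℝ} (hγ : 0 < γ) :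
    HasDerivAt (eps α β γ n)
      (β + α * (1 + γ / 2 * x ^ 2) ^ n +
        α * n * γ * x ^ 2 * (1 + γ / 2 * x ^ 2) ^ (n - 1)) x := by
  have hpos : 0 < 1 + γ / 2 * x ^ 2 := by positivity
  have hbase : HasDerivAt (fun y : ℝ => 1 + γ / 2 * y ^ 2) (γ * x) x := by
    refine (((hasDerivAt_pow 2 x).const_mul (γ / 2)).const_add 1).congr_deriv ?_
    norm_num
    ring
  refine (((hasDerivAt_id' x).const_mul β).add
    (((hbase.rpow_const (p := n) (Or.inl hpos.ne')).const_mul α).mul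
      (hasDerivAt_id' x))).congr_deriv ?_
  ring

theorem eps_div_self (α β γ n : ℝ) {x : ℝ} (hx : x ≠ 0) :
    eps α β γ n x / x = β + α * (1 + γ / 2 * x ^ 2) ^ n := by
  rw [eps, div_eq_iff hx]
  ring

theorem one_div_sqrt_mul_lt {ρ a b : ℝ} (hρ : 0 < ρ) (ha : 0 < a) (hab : a < b) :
    1 / Real.sqrt (ρ * b) < 1 / Real.sqrt (ρ * a) :=
  one_div_lt_one_div_of_lt (Real.sqrt_pos.2 (mul_pos hρ ha))
    (Real.sqrt_lt_sqrt (mul_pos hρ ha).le (mul_lt_mul_of_pos_left hab hρ))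

/-- Speed inequalities for the degenerate forward shock issuing from zero stress:
for `T ≠ 0`, `α + β = ε'(0) < ε(T)/T < ε'(T)`, so the shock speed
`s₂ = 1/√(ρ ε(T)/T)` satisfies `λ₂(0) > s₂ > λ₂(T)`. -/
theorem stmt_16 (α β γ n ρ T : ℝ) (hα : 0 < α) (hβ : β < 0) (hγ : 0 < γ)
    (hn : 0 < n) (hαβ : 0 < α + β) (hρ : 0 < ρ) (hT : T ≠ 0) :
    α + β = deriv (eps α β γ n) 0 ∧
    α + β < eps α β γ n T / T ∧
    eps α β γ n T / T < deriv (eps α β γ n) T ∧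
    1 / Real.sqrt (ρ * (eps α β γ n T / T)) <
      1 / Real.sqrt (ρ * deriv (eps α β γ n) 0) ∧
    1 / Real.sqrt (ρ * deriv (eps α β γ n) T) <
      1 / Real.sqrt (ρ * (eps α β γ n T / T)) := by
  have hzero : α + β = deriv (eps α β γ n) 0 := by
    rw [(hasDerivAt_eps_s16 α β n 0 hγ).deriv]
    simp [add_comm]
  have hsecant : α + β < eps α β γ n T / T := by
    have hpow : 1 < (1 + γ / 2 * T ^ 2) ^ n :=
      Real.one_lt_rpow (lt_add_of_pos_right 1 (by positivity)) hn
    rw [eps_div_self α β γ n hT]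
    linarith [mul_lt_mul_of_pos_left hpow hα]
  have htangent : eps α β γ n T / T < deriv (eps α β γ n) T := by
    rw [eps_div_self α β γ n hT, (hasDerivAt_eps_s16 α β n T hγ).deriv]
    exact lt_add_of_pos_right _ (by positivity)
  refine ⟨hzero, hsecant, htangent, ?_, one_div_sqrt_mul_lt hρ (hαβ.trans hsecant) htangent⟩
  rw [← hzero]
  exact one_div_sqrt_mul_lt hρ hαβ hsecant
end
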